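/- Let H be a minimal counterexample to the main theorem: a plane graph with Δ(H)=6, containing no subgraph isomorphic to a diamond or a house, in which every 6-vertex either is not incident with two 4-cycles sharing an edge or is not incident with three cycles of sizes p,q,ℓ for any {p,q,ℓ} ∈ {{3,4,4},{3,3,4}}, that is not totally 7-colorable, and that minimizes |V(H)|+|E(H)| among all such graphs. Then every vertex of degree 6 in H that is adjacent to a vertex of degree 2 has at most five neighbors of degree at most 3 (equivalently, no 6-vertex adjacent to a 2-vertex has all six of its neighbors of degree at most 3). -/

import Mathlib

open SimpleGraph

/-- The degree of a vertex, as `Nat.card` of its neighbor set. -/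
noncomputable def vdeg {V : Type*} (G : SimpleGraph V) (v : V) : ℕ :=
  Nat.card (G.neighborSet v)

/-- `G` has maximum degree exactly `k`. -/
def MaxDegreeEq {V : Type*} (G : SimpleGraph V) (k : ℕ) : Prop :=
  (∀ v, vdeg G v ≤ k) ∧ ∃ v, vdeg G v = k

/-- `G` admits a total `k`-coloring: a coloring of vertices and edges with `k` colors such
that adjacent vertices get distinct colors, edges sharing an endpoint get distinct colors,
and each edge gets a color distinct from those of its endpoints. -/
def TotallyColorable {V : Type*} (G : SimpleGraph V) (k : ℕ) : Prop :=
  ∃ (cv : V → Fin k) (ce : Sym2 V → Fin k),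
    (∀ ⦃u v⦄, G.Adj u v → cv u ≠ cv v) ∧
    (∀ e₁ ∈ G.edgeSet, ∀ e₂ ∈ G.edgeSet, e₁ ≠ e₂ → (∃ x, x ∈ e₁ ∧ x ∈ e₂) →
      ce e₁ ≠ ce e₂) ∧
    (∀ ⦃u v⦄, G.Adj u v → ce s(u, v) ≠ cv u)

/-- The diamond: `K₄` minus one edge. -/
def diamondGraph : SimpleGraph (Fin 4) :=
  SimpleGraph.fromEdgeSet {s(0, 1), s(0, 2), s(0, 3), s(1, 2), s(1, 3)}

/-- The house: a `4`-cycle `1 2 3 4` and a triangle `0 1 4` sharing exactly the edge `{1,4}`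
(equivalently, a `5`-cycle plus one chord). -/
def houseGraph : SimpleGraph (Fin 5) :=
  SimpleGraph.fromEdgeSet {s(0, 1), s(1, 2), s(2, 3), s(3, 4), s(4, 0), s(1, 4)}

/-- `G` contains a (not necessarily induced) subgraph isomorphic to `H`. -/
def ContainsCopy {α β : Type*} (H : SimpleGraph α) (G : SimpleGraph β) : Prop :=
  ∃ f : α → β, Function.Injective f ∧ ∀ ⦃u v⦄, H.Adj u v → G.Adj (f u) (f v)

/-- `v` is incident with two distinct `4`-cycles of `G` that share an edge. -/
def TwoAdjacentFourCyclesAt {V : Type*} (G : SimpleGraph V) (v : V) : Prop :=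
  ∃ (c₁ c₂ : G.Walk v v), c₁.IsCycle ∧ c₂.IsCycle ∧ c₁.length = 4 ∧ c₂.length = 4 ∧
    {e | e ∈ c₁.edges} ≠ {e | e ∈ c₂.edges} ∧ ∃ e, e ∈ c₁.edges ∧ e ∈ c₂.edges

/-- `v` is incident with three pairwise distinct cycles of `G`, of lengths `p`, `q`, `ℓ`. -/
def ThreeCyclesAt {V : Type*} (G : SimpleGraph V) (v : V) (p q ℓ : ℕ) : Prop :=
  ∃ (c₁ c₂ c₃ : G.Walk v v), c₁.IsCycle ∧ c₂.IsCycle ∧ c₃.IsCycle ∧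
    c₁.length = p ∧ c₂.length = q ∧ c₃.length = ℓ ∧
    {e | e ∈ c₁.edges} ≠ {e | e ∈ c₂.edges} ∧
    {e | e ∈ c₁.edges} ≠ {e | e ∈ c₃.edges} ∧
    {e | e ∈ c₂.edges} ≠ {e | e ∈ c₃.edges}

/-- Every `6`-vertex of `G` is not incident with two `4`-cycles sharing an edge, or is not
incident with three cycles of sizes `p, q, ℓ` for any `{p,q,ℓ} ∈ {{3,4,4},{3,3,4}}`. -/
def Good6Vertices {V : Type*} (G : SimpleGraph V) : Prop :=
  ∀ v, vdeg G v = 6 →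
    (¬ TwoAdjacentFourCyclesAt G v) ∨
    (∀ p q ℓ : ℕ, (({p, q, ℓ} : Multiset ℕ) = {3, 4, 4} ∨ ({p, q, ℓ} : Multiset ℕ) = {3, 3, 4}) →
      ¬ ThreeCyclesAt G v p q ℓ)

/-- Reversal of darts, as a permutation. -/
def dartRev {V : Type*} (G : SimpleGraph V) : Equiv.Perm G.Dart :=
  Function.Involutive.toPerm SimpleGraph.Dart.symm SimpleGraph.Dart.symm_involutive

/-- A rotation system (combinatorial embedding) of `G`: a permutation of the darts whose
orbits are exactly the sets of darts emanating from each single vertex. -/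
structure RotationSystem {V : Type*} (G : SimpleGraph V) where
  σ : Equiv.Perm G.Dart
  tail_fixed : ∀ d : G.Dart, (σ d).fst = d.fst
  vertex_cycles : ∀ d d' : G.Dart, d.fst = d'.fst → σ.SameCycle d d'

namespace RotationSystem

variable {V : Type*} {G : SimpleGraph V}

/-- The face-tracing permutation of a rotation system. -/
def φ (R : RotationSystem G) : Equiv.Perm G.Dart :=
  R.σ * dartRev G

/-- Two darts lie on the same face iff they are in the same orbit of the face-tracing
permutation. -/
def faceSetoid (R : RotationSystem G) : Setoid G.Dart where
  r := R.φ.SameCycle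
  iseqv := ⟨fun d => Equiv.Perm.SameCycle.refl _ d, Equiv.Perm.SameCycle.symm,
    Equiv.Perm.SameCycle.trans⟩

/-- The faces of the embedding: orbits of the face-tracing permutation. -/
def Faces (R : RotationSystem G) : Type _ :=
  Quotient R.faceSetoid

/-- The number of faces of the embedding. -/
noncomputable def numFaces (R : RotationSystem G) : ℕ :=
  Nat.card R.Faces

/-- The darts of the face containing the dart `d`. -/
def faceDarts (R : RotationSystem G) (d : G.Dart) : Set G.Dart :=
  {d' | R.φ.SameCycle d d'}

/-- The degree (length of the boundary walk, cut edges counted twice) of the face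
containing the dart `d`. -/
noncomputable def faceDeg (R : RotationSystem G) (d : G.Dart) : ℕ :=
  (R.faceDarts d).ncard

/-- The vertex `v` is incident with the face containing the dart `d`. -/
def FaceIncident (R : RotationSystem G) (v : V) (d : G.Dart) : Prop :=
  ∃ d' ∈ R.faceDarts d, d'.fst = v

/-- A rotation system is a plane embedding when it satisfies Euler's formula
`|V| - |E| + |F| = 2` on each connected component, i.e. `|V| + |F| = |E| + 2c`. -/
def IsPlanarEmbedding [Fintype V] (R : RotationSystem G) : Prop :=
  Fintype.card V + R.numFaces = Nat.card G.edgeSet + 2 * Nat.card G.ConnectedComponent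

end RotationSystem

/-- A graph is planar if it admits a plane embedding. -/
def IsPlanar {V : Type*} [Fintype V] (G : SimpleGraph V) : Prop :=
  ∃ R : RotationSystem G, R.IsPlanarEmbedding

/-- Conditions (1), (2), (3) on graphs in Theorem 1: planar of maximum degree 6, with no
diamond and no house subgraph, and every 6-vertex not incident with two adjacent 4-cycles
or not incident with three cycles of sizes in `{{3,4,4},{3,3,4}}`. -/
def GoodGraph {V : Type*} [Fintype V] (G : SimpleGraph V) : Prop :=
  IsPlanar G ∧ MaxDegreeEq G 6 ∧ ¬ ContainsCopy diamondGraph G ∧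
    ¬ ContainsCopy houseGraph G ∧ Good6Vertices G

/-- `H` is a minimal counterexample to the main theorem: it satisfies conditions (1)–(3),
is not totally 7-colorable, and minimizes `|V| + |E|` among all such graphs. -/
def MinimalCounterexample {V : Type*} [Fintype V] (H : SimpleGraph V) : Prop :=
  GoodGraph H ∧ ¬ TotallyColorable H 7 ∧
    ∀ (n : ℕ) (G : SimpleGraph (Fin n)), GoodGraph G → ¬ TotallyColorable G 7 →
      Fintype.card V + Nat.card H.edgeSet ≤ n + Nat.card G.edgeSet

namespace MC

open Equiv Equiv.Perm

/-- merging two classes -/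
def mergeS {α : Type*} (r : Setoid α) (a b : α) : Setoid α where
  r x y := r x y ∨ (r x a ∧ r b y) ∨ (r x b ∧ r a y)
  iseqv := by
    refine ⟨fun x => Or.inl (r.refl x), ?_, ?_⟩
    · rintro x y (h | ⟨h, h'⟩ | ⟨h, h'⟩)
      · exact Or.inl (r.symm h)
      · exact Or.inr (Or.inr ⟨r.symm h', r.symm h⟩)
      · exact Or.inr (Or.inl ⟨r.symm h', r.symm h⟩)
    · rintro x y z (h | ⟨h, h'⟩ | ⟨h, h'⟩) (k | ⟨k, k'⟩ | ⟨k, k'⟩)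
      · exact Or.inl (r.trans h k)
      · exact Or.inr (Or.inl ⟨r.trans h k, k'⟩)
      · exact Or.inr (Or.inr ⟨r.trans h k, k'⟩)
      · exact Or.inr (Or.inl ⟨h, r.trans h' k⟩)
      · exact Or.inr (Or.inl ⟨h, k'⟩)
      · exact Or.inl (r.trans h k')
      · exact Or.inr (Or.inr ⟨h, r.trans h' k⟩)
      · exact Or.inl (r.trans h k')
      · exact Or.inr (Or.inr ⟨h, k'⟩)

lemma mergeS_apply {α : Type*} {r : Setoid α} {a b x y : α} :
    mergeS r a b x y ↔ (r x y ∨ (r x a ∧ r b y) ∨ (r x b ∧ r a y)) := Iff.rfl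

lemma le_mergeS {α : Type*} (r : Setoid α) (a b : α) : r ≤ mergeS r a b :=
  fun _ _ h => Or.inl h

lemma mergeS_rel {α : Type*} (r : Setoid α) (a b : α) : mergeS r a b a b :=
  Or.inr (Or.inl ⟨r.refl a, r.refl b⟩)

lemma mergeS_le {α : Type*} {r s : Setoid α} {a b : α} (h : r ≤ s) (hab : s a b) :
    mergeS r a b ≤ s := by
  rintro x y (k | ⟨k, k'⟩ | ⟨k, k'⟩)
  · exact h k
  · exact s.trans (h k) (s.trans hab (h k'))
  · exact s.trans (h k) (s.trans (s.symm hab) (h k'))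

lemma mergeS_eq {α : Type*} {r : Setoid α} {a b : α} (h : r a b) : mergeS r a b = r :=
  le_antisymm (mergeS_le le_rfl h) (le_mergeS _ _ _)

lemma card_mergeS {α : Type*} [Finite α] {r : Setoid α} {a b : α} (h : ¬ r a b) :
    Nat.card (Quotient r) = Nat.card (Quotient (mergeS r a b)) + 1 := by
  classical
  let m : Quotient r → Quotient (mergeS r a b) := Quotient.map id (fun _ _ h => Or.inl h)
  let g : Option (Quotient (mergeS r a b)) ≃ Quotient r := by
    refine Equiv.trans (Equiv.optionCongr (Equiv.ofBijective
      (fun q : {q : Quotient r // q ≠ Quotient.mk r b} => m q.1) ⟨?_, ?_⟩).symm)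
      (Equiv.optionSubtypeNe (Quotient.mk r b))
    · rintro ⟨p, hp⟩ ⟨q, hq⟩ hpq
      induction p using Quotient.inductionOn
      induction q using Quotient.inductionOn
      rename_i x y
      have hpq' : mergeS r a b x y := Quotient.exact hpq
      have hx : ¬ r x b := fun h => hp (Quotient.sound h)
      have hy : ¬ r y b := fun h => hq (Quotient.sound h)
      rw [mergeS_apply] at hpq'
      rcases hpq' with k | ⟨k, k'⟩ | ⟨k, k'⟩
      · exact Subtype.ext (Quotient.sound k)
      · exact absurd (r.symm k') hy
      · exact absurd k hx
    · intro q
      induction q using Quotient.inductionOn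
      rename_i x
      by_cases hx : r x b
      · exact ⟨⟨Quotient.mk r a, fun k => h (Quotient.exact k)⟩,
          Quotient.sound (Or.inr (Or.inl ⟨r.refl a, r.symm hx⟩))⟩
      · exact ⟨⟨Quotient.mk r x, fun k => hx (Quotient.exact k)⟩, rfl⟩
  rw [← Nat.card_congr g, Finite.card_option]

/-- number of cycles, fixed points included -/
noncomputable def orb {α : Type*} (f : Perm α) : ℕ := Nat.card (Quotient (SameCycle.setoid f))

lemma sc_le {α : Type*} [Finite α] {f : Perm α} {s : Setoid α} (h : ∀ x, s x (f x)) :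
    SameCycle.setoid f ≤ s := by
  intro x y hxy
  obtain ⟨n, -, hn⟩ := (show SameCycle f x y from hxy).exists_pow_eq'
  subst hn
  clear hxy
  induction n with
  | zero => exact s.refl x
  | succ n ih => rw [pow_succ']; exact s.trans ih (h _)

lemma sc_swap_le {α : Type*} [Finite α] [DecidableEq α] (f : Perm α) (a b : α) :
    SameCycle.setoid (swap a b * f) ≤ mergeS (SameCycle.setoid f) a b := by
  apply sc_le
  intro x
  have h : SameCycle.setoid f x (f x) := (sameCycle_apply_right.2 (SameCycle.refl f x))
  simp only [Perm.mul_apply]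
  by_cases h1 : f x = a
  · rw [h1, swap_apply_left]; rw [h1] at h
    exact Or.inr (Or.inl ⟨h, (SameCycle.setoid f).refl _⟩)
  · by_cases h2 : f x = b
    · rw [h2, swap_apply_right]; rw [h2] at h
      exact Or.inr (Or.inr ⟨h, (SameCycle.setoid f).refl _⟩)
    · rw [swap_apply_of_ne_of_ne h1 h2]; exact Or.inl h

lemma merge_swap {α : Type*} [Finite α] [DecidableEq α] (f : Perm α) (a b : α) :
    mergeS (SameCycle.setoid (swap a b * f)) a b = mergeS (SameCycle.setoid f) a b := by
  apply le_antisymm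
  · exact mergeS_le (sc_swap_le f a b) (mergeS_rel _ _ _)
  · refine mergeS_le ?_ (mergeS_rel _ _ _)
    have := sc_swap_le (swap a b * f) a b
    rwa [swap_mul_self_mul] at this

lemma same_swap_of_not {α : Type*} [Finite α] [DecidableEq α] {f : Perm α} {a b : α}
    (h : ¬ SameCycle f a b) : SameCycle (swap a b * f) a b := by
  by_contra hg
  -- the set of points in the new cycle of a and old cycle of a
  have key : ∀ n : ℕ, SameCycle (swap a b * f) a ((f ^ n) a) := by
    intro n
    induction n with
    | zero => exact SameCycle.refl _ _
    | succ n ih =>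
      have h1 : SameCycle (swap a b * f) a ((swap a b * f) ((f ^ n) a)) :=
        sameCycle_apply_right.2 ih
      rw [Perm.mul_apply, ← Perm.mul_apply f, ← pow_succ'] at h1
      have hb : (f ^ (n + 1)) a ≠ b := fun k => h ⟨(n + 1 : ℕ), by rw [zpow_natCast, k]⟩
      by_cases ha : (f ^ (n + 1)) a = a
      · rw [ha]
      · rwa [swap_apply_of_ne_of_ne ha hb] at h1
  have h2 : SameCycle f a (f⁻¹ a) := ⟨-1, by simp⟩
  obtain ⟨n, -, hn⟩ := h2.exists_pow_eq'
  have h3 := key n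
  rw [hn] at h3
  apply hg
  have h4 := sameCycle_apply_right.2 h3
  simpa using h4

lemma not_same_swap {α : Type*} [Finite α] [DecidableEq α] {f : Perm α} {a b : α} (hab : a ≠ b)
    (h : SameCycle f a b) : ¬ SameCycle (swap a b * f) a b := by
  classical
  have hex : ∃ n : ℕ, (f ^ n) a = b := by
    obtain ⟨n, -, hn⟩ := h.exists_pow_eq'
    exact ⟨n, hn⟩
  let k := Nat.find hex
  have hk : (f ^ k) a = b := Nat.find_spec hex
  have hmin : ∀ m < k, (f ^ m) a ≠ b := fun m hm => Nat.find_min hex hm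
  have hk0 : 0 < k := by
    rcases Nat.eq_zero_or_pos k with h0 | h0
    · rw [h0] at hk; exact absurd hk hab
    · exact h0
  intro hg
  obtain ⟨n, -, hn⟩ := hg.exists_pow_eq'
  have key : ∀ n : ℕ, ∃ i < k, ((swap a b * f) ^ n) a = (f ^ i) a := by
    intro n
    induction n with
    | zero => exact ⟨0, hk0, rfl⟩
    | succ n ih =>
      obtain ⟨i, hi, hi'⟩ := ih
      rw [pow_succ', Perm.mul_apply, hi', Perm.mul_apply, ← Perm.mul_apply f, ← pow_succ']
      by_cases h1 : (f ^ (i + 1)) a = b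
      · exact ⟨0, hk0, by rw [h1]; simp⟩
      · by_cases h2 : (f ^ (i + 1)) a = a
        · exfalso
          -- then b = f^k a = f^(k-(i+1)) a
          apply hmin (k - (i + 1)) (by omega)
          have : (f ^ (k - (i + 1))) ((f ^ (i + 1)) a) = b := by
            rw [← Perm.mul_apply, ← pow_add, Nat.sub_add_cancel (by omega), hk]
          rwa [h2] at this
        · refine ⟨i + 1, ?_, by rw [swap_apply_of_ne_of_ne h2 h1]⟩
          rcases Nat.lt_or_ge (i + 1) k with h3 | h3
          · exact h3
          · have : i + 1 = k := by omega
            rw [this] at h1; exact absurd hk h1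
  obtain ⟨i, hi, hi'⟩ := key n
  exact hmin i hi (by rw [← hi', hn])

lemma orb_swap_same {α : Type*} [Finite α] [DecidableEq α] {f : Perm α} {a b : α} (hab : a ≠ b)
    (h : SameCycle f a b) : orb (swap a b * f) = orb f + 1 := by
  unfold orb
  rw [card_mergeS (r := SameCycle.setoid (swap a b * f)) (a := a) (b := b)
    (not_same_swap hab h), merge_swap, mergeS_eq h]

lemma orb_swap_not {α : Type*} [Finite α] [DecidableEq α] {f : Perm α} {a b : α}
    (h : ¬ SameCycle f a b) : orb (swap a b * f) + 1 = orb f := by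
  unfold orb
  rw [card_mergeS (r := SameCycle.setoid f) (a := a) (b := b) h,
    ← merge_swap, mergeS_eq (same_swap_of_not h)]

lemma orb_mul_swap_same {α : Type*} [Finite α] [DecidableEq α] {f : Perm α} {a b : α}
    (hab : a ≠ b) (h : SameCycle f a b) : orb (f * swap a b) = orb f + 1 := by
  rw [mul_swap_eq_swap_mul]
  exact orb_swap_same (fun k => hab (f.injective k))
    (sameCycle_apply_left.2 (sameCycle_apply_right.2 h))

lemma orb_mul_swap_not {α : Type*} [Finite α] [DecidableEq α] {f : Perm α} {a b : α}
    (h : ¬ SameCycle f a b) : orb (f * swap a b) + 1 = orb f := by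
  rw [mul_swap_eq_swap_mul]
  exact orb_swap_not (fun k => h (sameCycle_apply_left.1 (sameCycle_apply_right.1 k)))

/-- make `d` a fixed point by skipping it -/
def isol {α : Type*} [DecidableEq α] (f : Perm α) (d : α) : Perm α := swap d (f d) * f

lemma isol_self {α : Type*} [DecidableEq α] (f : Perm α) (d : α) : isol f d d = d := by
  simp [isol]

lemma fixed_of_same {α : Type*} {f : Perm α} {d x : α} (h : f d = d)
    (hs : SameCycle f x d) : x = d := by
  obtain ⟨n, hn⟩ := hs.symm
  rw [← hn]
  exact (zpow_apply_eq_self_of_apply_eq_self h n)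

lemma isol_same {α : Type*} [Finite α] [DecidableEq α] {f : Perm α} {d x y : α}
    (h : SameCycle f x y) (hx : x ≠ d) (hy : y ≠ d) : SameCycle (isol f d) x y := by
  have h1 : mergeS (SameCycle.setoid (isol f d)) d (f d) x y := by
    unfold isol; rw [merge_swap]; exact Or.inl h
  rcases h1 with h | ⟨h, h'⟩ | ⟨h, h'⟩
  · exact h
  · exact absurd (fixed_of_same (isol_self f d) h) hx
  · exact absurd (fixed_of_same (isol_self f d) (SameCycle.symm h')) hy

lemma orb_isol {α : Type*} [Finite α] [DecidableEq α] (f : Perm α) (d : α) :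
    orb (isol f d) = orb f + if f d = d then 0 else 1 := by
  split_ifs with h
  · simp only [isol, h, swap_self, add_zero]; rfl
  · exact orb_swap_same (Ne.symm h) (sameCycle_apply_right.2 (SameCycle.refl _ _))

lemma semi_zpow {α β : Type*} {f : Perm α} {g : Perm β} {ι : α → β}
    (h : ∀ x, ι (f x) = g (ι x)) (n : ℕ) (x : α) : ι ((f ^ n) x) = (g ^ n) (ι x) := by
  induction n with
  | zero => rfl
  | succ n ih => rw [pow_succ', pow_succ', Perm.mul_apply, Perm.mul_apply, h, ih]

lemma same_semi {α β : Type*} [Finite α] [Finite β] {f : Perm α} {g : Perm β} {ι : α → β}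
    (hi : Function.Injective ι)
    (h : ∀ x, ι (f x) = g (ι x)) (x y : α) : SameCycle f x y ↔ SameCycle g (ι x) (ι y) := by
  constructor
  · intro hs
    obtain ⟨n, -, hn⟩ := hs.exists_pow_eq'
    exact ⟨n, by rw [zpow_natCast, ← semi_zpow h, hn]⟩
  · intro hs
    obtain ⟨n, -, hn⟩ := hs.exists_pow_eq'
    rw [← semi_zpow h] at hn
    exact ⟨n, by rw [zpow_natCast]; exact hi hn⟩

lemma orb_restrict {α β : Type*} [Finite α] [Finite β] {f : Perm α} {g : Perm β} {ι : α → β}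
    (hi : Function.Injective ι) (h : ∀ x, ι (f x) = g (ι x))
    (hfix : ∀ d, d ∉ Set.range ι → g d = d) :
    orb g = orb f + Nat.card ↥(Set.range ι)ᶜ := by
  unfold orb
  rw [← Nat.card_sum]
  let F : Quotient (SameCycle.setoid f) ⊕ ↥(Set.range ι)ᶜ → Quotient (SameCycle.setoid g) :=
    Sum.elim (Quotient.map ι (fun x y hxy => (same_semi hi h x y).1 hxy)) (fun d => Quotient.mk _ d.1)
  refine (Nat.card_congr (Equiv.ofBijective F ⟨?_, ?_⟩)).symm
  · have key : ∀ (x : α) (d : β), d ∉ Set.range ι → ¬ SameCycle g (ι x) d := by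
      intro x d hd hs
      exact hd ⟨x, fixed_of_same (hfix d hd) hs⟩
    rintro (p | ⟨d, hd⟩) (q | ⟨e, he⟩) hpq
    · induction p using Quotient.inductionOn
      induction q using Quotient.inductionOn
      rename_i x y
      have : SameCycle g (ι x) (ι y) := Quotient.exact hpq
      exact congrArg _ (Quotient.sound ((same_semi hi h x y).2 this))
    · induction p using Quotient.inductionOn
      rename_i x
      exact absurd (Quotient.exact hpq) (key x e he)
    · induction q using Quotient.inductionOn
      rename_i x
      exact absurd (Quotient.exact hpq.symm) (key x d hd)
    · have : SameCycle g d e := Quotient.exact hpq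
      have := fixed_of_same (hfix e he) this
      subst this; rfl
  · intro q
    induction q using Quotient.inductionOn
    rename_i d
    by_cases hd : d ∈ Set.range ι
    · obtain ⟨x, rfl⟩ := hd
      exact ⟨Sum.inl (Quotient.mk _ x), rfl⟩
    · exact ⟨Sum.inr ⟨d, hd⟩, rfl⟩

lemma exists_restrict {α β : Type*} [Finite α] (g : Perm β) {ι : α → β}
    (hi : Function.Injective ι) (h : ∀ d, d ∈ Set.range ι → g d ∈ Set.range ι) :
    ∃ f : Perm α, ∀ x, ι (f x) = g (ι x) := by
  choose f hf using fun x => h (ι x) ⟨x, rfl⟩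
  have hinj : Function.Injective f := by
    intro x y hxy
    apply hi; apply g.injective
    rw [← hf, ← hf, hxy]
  exact ⟨Equiv.ofBijective f (Finite.injective_iff_bijective.1 hinj), hf⟩

end MC
namespace MC

open Equiv Equiv.Perm

instance dartFin {V : Type*} [Finite V] (G : SimpleGraph V) : Finite G.Dart :=
  Finite.of_injective _ (SimpleGraph.Dart.toProd_injective (G := G))

lemma reach_le {V : Type*} {G : SimpleGraph V} {s : Setoid V} (h : ∀ u w, G.Adj u w → s u w) :
    G.reachableSetoid ≤ s := by
  rintro x y ⟨p⟩
  induction p with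
  | nil => exact s.refl _
  | cons hadj p ih => exact s.trans (h _ _ hadj) ih

abbrev delE {V : Type*} (H : SimpleGraph V) (a b : V) : SimpleGraph V := H.deleteEdges {s(a, b)}

lemma delE_adj {V : Type*} {H : SimpleGraph V} {a b u w : V} :
    (delE H a b).Adj u w ↔ H.Adj u w ∧ s(u, w) ≠ s(a, b) := by
  simp [delE, SimpleGraph.deleteEdges_adj]

lemma reach_merge {V : Type*} {H : SimpleGraph V} {a b : V} (hab : H.Adj a b) :
    H.reachableSetoid = mergeS (delE H a b).reachableSetoid a b := by
  apply le_antisymm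
  · apply reach_le
    intro u w huw
    by_cases h : s(u, w) = s(a, b)
    · rcases Sym2.eq_iff.1 h with ⟨rfl, rfl⟩ | ⟨rfl, rfl⟩
      · exact mergeS_rel _ _ _
      · exact Setoid.symm' _ (mergeS_rel _ _ _)
    · exact Or.inl (SimpleGraph.Adj.reachable (delE_adj.2 ⟨huw, h⟩))
  · refine mergeS_le ?_ hab.reachable
    apply reach_le
    intro u w huw
    exact SimpleGraph.Adj.reachable (delE_adj.1 huw).1

noncomputable def compN {V : Type*} (G : SimpleGraph V) : ℕ := Nat.card G.ConnectedComponent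

lemma comp_bridge {V : Type*} [Finite V] {H : SimpleGraph V} {a b : V} (hab : H.Adj a b)
    (h : ¬ (delE H a b).Reachable a b) : compN (delE H a b) = compN H + 1 := by
  have := card_mergeS (r := (delE H a b).reachableSetoid) (a := a) (b := b) h
  rw [← reach_merge hab] at this
  exact this

lemma comp_nonbridge {V : Type*} {H : SimpleGraph V} {a b : V} (hab : H.Adj a b)
    (h : (delE H a b).Reachable a b) : compN (delE H a b) = compN H := by
  have := mergeS_eq (r := (delE H a b).reachableSetoid) (a := a) (b := b) h
  rw [← reach_merge hab] at this
  have e1 : compN H = Nat.card (Quotient H.reachableSetoid) := rfl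
  have e2 : compN (delE H a b) = Nat.card (Quotient (delE H a b).reachableSetoid) := rfl
  rw [e1, e2, this]

def Iso {V : Type*} (G : SimpleGraph V) (v : V) : Prop := ∀ w, ¬ G.Adj v w

noncomputable def isoN {V : Type*} (G : SimpleGraph V) : ℕ := {v | Iso G v}.ncard

open Classical in
lemma iso_del {V : Type*} [Finite V] {H : SimpleGraph V} {a b : V} (hab : H.Adj a b) :
    isoN (delE H a b) = isoN H + (if Iso (delE H a b) a then 1 else 0)
      + (if Iso (delE H a b) b then 1 else 0) := by
  unfold isoN
  have hne := hab.ne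
  have hset : {v | Iso (delE H a b) v} =
      ({v | Iso H v} ∪ {v | v = a ∧ Iso (delE H a b) a}) ∪ {v | v = b ∧ Iso (delE H a b) b} := by
    ext v
    simp only [Set.mem_ofPred_eq, Set.mem_union]
    constructor
    · intro h
      by_cases ha : v = a
      · subst ha; exact Or.inl (Or.inr ⟨rfl, h⟩)
      by_cases hb : v = b
      · subst hb; exact Or.inr ⟨rfl, h⟩
      refine Or.inl (Or.inl fun w hw => h w (delE_adj.2 ⟨hw, fun k => ?_⟩))
      rcases Sym2.eq_iff.1 k with ⟨h1, h2⟩ | ⟨h1, h2⟩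
      · exact ha h1
      · exact hb h1
    · rintro ((h | ⟨rfl, h⟩) | ⟨rfl, h⟩)
      · exact fun w hw => h w (delE_adj.1 hw).1
      · exact h
      · exact h
  have hc : ∀ (x : V) (P : Prop), ({v | v = x ∧ P} : Set V).ncard = if P then 1 else 0 := by
    intro x P
    by_cases hP : P <;> simp [hP]
  rw [hset, Set.ncard_union_eq, Set.ncard_union_eq, hc, hc]
  · rw [Set.disjoint_left]
    rintro v h ⟨rfl, -⟩
    exact h _ hab
  · rw [Set.disjoint_left]
    rintro v (h | ⟨rfl, -⟩) ⟨h', -⟩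
    · subst h'; exact h _ hab.symm
    · exact hne h'

lemma numFaces_eq {V : Type*} {G : SimpleGraph V} (R : RotationSystem G) :
    R.numFaces = orb R.φ := rfl

lemma phi_apply {V : Type*} {G : SimpleGraph V} (R : RotationSystem G) (d : G.Dart) :
    R.φ d = R.σ d.symm := rfl

/-- `σ d = d` iff the tail becomes isolated after the deletion of the edge. -/
lemma fixed_iff {V : Type*} [Finite V] {H : SimpleGraph V} (R : RotationSystem H) {a b : V}
    (hab : H.Adj a b) : R.σ ⟨(a, b), hab⟩ = ⟨(a, b), hab⟩ ↔ Iso (delE H a b) a := by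
  constructor
  · intro h w hw
    obtain ⟨h1, h2⟩ := delE_adj.1 hw
    have := R.vertex_cycles ⟨(a, w), h1⟩ ⟨(a, b), hab⟩ rfl
    have := fixed_of_same h this
    simp only [SimpleGraph.Dart.mk.injEq, Prod.mk.injEq, true_and] at this
    exact h2 (by rw [this])
  · intro h
    have ht := R.tail_fixed ⟨(a, b), hab⟩
    generalize R.σ ⟨(a, b), hab⟩ = d at ht
    obtain ⟨⟨x, y⟩, hd⟩ := d
    simp only at ht hd
    subst ht
    by_contra hne
    apply h y
    refine delE_adj.2 ⟨hd, fun k => hne ?_⟩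
    rcases Sym2.eq_iff.1 k with ⟨h1, h2⟩ | ⟨h1, h2⟩
    · subst h2; rfl
    · exact absurd h1 hab.ne

lemma same_of_bridge {V : Type*} [Finite V] {H : SimpleGraph V} (R : RotationSystem H) {a b : V}
    (hab : H.Adj a b) (h : ¬ (delE H a b).Reachable a b) :
    R.φ.SameCycle ⟨(a, b), hab⟩ ⟨(b, a), hab.symm⟩ := by
  classical
  by_contra hs
  set d1 : H.Dart := ⟨(a, b), hab⟩ with hd1
  have hex : ∃ n : ℕ, 0 < n ∧ (R.φ ^ n) d1 = d1 := by
    refine ⟨orderOf R.φ, orderOf_pos _, ?_⟩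
    rw [pow_orderOf_eq_one]; rfl
  let k := Nat.find hex
  obtain ⟨hk0, hk⟩ : 0 < k ∧ (R.φ ^ k) d1 = d1 := Nat.find_spec hex
  have hmin : ∀ m < k, 0 < m → (R.φ ^ m) d1 ≠ d1 := fun m hm h0 h1 => Nat.find_min hex hm ⟨h0, h1⟩
  have hfst : ∀ d : H.Dart, (R.φ d).fst = d.snd := by
    intro d; rw [phi_apply, R.tail_fixed]; rfl
  have key : ∀ n : ℕ, n + 1 ≤ k → (delE H a b).Reachable b ((R.φ ^ (n + 1)) d1).fst := by
    intro n
    induction n with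
    | zero => intro _; rw [zero_add, pow_one, hfst]
    | succ n ih =>
      intro hn
      refine (ih (by omega)).trans ?_
      rw [pow_succ' _ (n + 1), Perm.mul_apply, hfst]
      apply SimpleGraph.Adj.reachable
      refine delE_adj.2 ⟨((R.φ ^ (n + 1)) d1).adj, fun hk' => ?_⟩
      have hne1 := hmin (n + 1) (by omega) (by omega)
      rcases Sym2.eq_iff.1 hk' with ⟨h1, h2⟩ | ⟨h1, h2⟩
      · exact hne1 (SimpleGraph.Dart.ext _ _ (Prod.ext h1 h2))
      · refine hs ⟨(n + 1 : ℕ), ?_⟩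
        rw [zpow_natCast]
        exact SimpleGraph.Dart.ext _ _ (Prod.ext h1 h2)
  have := key (k - 1) (by omega)
  rw [Nat.sub_add_cancel hk0, hk] at this
  exact h this.symm

lemma isol_mul {α : Type*} [DecidableEq α] (f t : Perm α) (d : α) (h : t d = d) :
    isol f d * t = isol (f * t) d := by
  simp only [isol, Perm.mul_apply, h, mul_assoc]

lemma delete_step {V : Type*} [Finite V] {H : SimpleGraph V} (R : RotationSystem H) {a b : V}
    (hab : H.Adj a b) : ∃ R' : RotationSystem (delE H a b),
      (R.φ.SameCycle ⟨(a, b), hab⟩ ⟨(b, a), hab.symm⟩ →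
        R'.numFaces + isoN (delE H a b) = R.numFaces + isoN H + 1) ∧
      (¬ R.φ.SameCycle ⟨(a, b), hab⟩ ⟨(b, a), hab.symm⟩ →
        R'.numFaces + isoN (delE H a b) + 1 = R.numFaces + isoN H) := by
  classical
  have hne := hab.ne
  set d1 : H.Dart := ⟨(a, b), hab⟩ with hd1
  set d2 : H.Dart := ⟨(b, a), hab.symm⟩ with hd2
  have hd12 : d1 ≠ d2 := by
    intro h
    have := congrArg (fun d : H.Dart => d.fst) h
    exact hne this
  let ι : (delE H a b).Dart → H.Dart := fun d => ⟨d.toProd, (delE_adj.1 d.adj).1⟩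
  have hι : Function.Injective ι := by
    intro d e h
    apply SimpleGraph.Dart.ext
    exact congrArg (fun d : H.Dart => d.toProd) h
  have hcompl : (Set.range ι)ᶜ = {d1, d2} := by
    ext d
    simp only [Set.mem_compl_iff, Set.mem_range, Set.mem_insert_iff, Set.mem_singleton_iff]
    constructor
    · intro h
      by_contra hcon
      push Not at hcon
      apply h
      refine ⟨⟨d.toProd, delE_adj.2 ⟨d.adj, fun k => ?_⟩⟩, rfl⟩
      rcases Sym2.eq_iff.1 k with ⟨h1, h2⟩ | ⟨h1, h2⟩
      · exact hcon.1 (SimpleGraph.Dart.ext _ _ (Prod.ext h1 h2))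
      · exact hcon.2 (SimpleGraph.Dart.ext _ _ (Prod.ext h1 h2))
    · rintro h ⟨e, rfl⟩
      have := (delE_adj.1 e.adj).2
      rcases h with h | h
      · have := congrArg (fun d : H.Dart => d.edge) h
        exact (delE_adj.1 e.adj).2 this
      · have := congrArg (fun d : H.Dart => d.edge) h
        exact (delE_adj.1 e.adj).2 (this.trans Sym2.eq_swap)
  have hrange : ∀ d, d ∈ Set.range ι ↔ d ≠ d1 ∧ d ≠ d2 := by
    intro d
    rw [← not_iff_not, ← Set.mem_compl_iff, hcompl]
    simp only [Set.mem_insert_iff, Set.mem_singleton_iff]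
    tauto
  have hcard : Nat.card ↥(Set.range ι)ᶜ = 2 := by
    rw [Nat.card_coe_set_eq, hcompl, Set.ncard_pair hd12]
  let σ1 := isol R.σ d1
  let σ2 := isol σ1 d2
  have t1 : ∀ d, (σ1 d).fst = d.fst := by
    intro d
    by_cases h : R.σ d = d1
    · have := R.tail_fixed d
      rw [h] at this
      rw [← this, ← R.tail_fixed d1]
      simp [σ1, isol, h]
    · by_cases h2 : R.σ d = R.σ d1
      · have : d = d1 := R.σ.injective h2
        rw [this]
        exact congrArg (fun d : H.Dart => d.fst) (isol_self _ _)
      · rw [← R.tail_fixed d]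
        simp only [σ1, isol, Perm.mul_apply, swap_apply_of_ne_of_ne h h2]
  have t2 : ∀ d, (σ2 d).fst = d.fst := by
    intro d
    by_cases h : σ1 d = d2
    · have := t1 d
      rw [h] at this
      rw [← this, ← t1 d2]
      simp [σ2, isol, h]
    · by_cases h2 : σ1 d = σ1 d2
      · have : d = d2 := σ1.injective h2
        rw [this]
        exact congrArg (fun d : H.Dart => d.fst) (isol_self _ _)
      · rw [← t1 d]
        simp only [σ2]
        rw [isol, Perm.mul_apply, swap_apply_of_ne_of_ne h h2]
  have s11 : σ1 d1 = d1 := isol_self _ _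
  have s12 : σ1 d2 = R.σ d2 := by
    have h1 : R.σ d2 ≠ d1 := by
      intro h
      have := R.tail_fixed d2
      rw [h] at this
      exact hne this
    have h2 : R.σ d2 ≠ R.σ d1 := fun h => hd12 (R.σ.injective h).symm
    simp only [σ1, isol, Perm.mul_apply, swap_apply_of_ne_of_ne h1 h2]
  have s22 : σ2 d2 = d2 := isol_self _ _
  have s21 : σ2 d1 = d1 := by
    have h2 : d1 ≠ σ1 d2 := fun h => hd12 (σ1.injective (s11.trans h))
    simp only [σ2]
    rw [isol, Perm.mul_apply, s11, swap_apply_of_ne_of_ne hd12 h2]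
  obtain ⟨σ', hσ'⟩ := exists_restrict σ2 hι (by
    intro d hd
    rw [hrange] at hd ⊢
    exact ⟨fun h => hd.1 (σ2.injective (h.trans s21.symm)),
      fun h => hd.2 (σ2.injective (h.trans s22.symm))⟩)
  let R' : RotationSystem (delE H a b) :=
    { σ := σ'
      tail_fixed := by
        intro d
        have := congrArg (fun d : H.Dart => d.fst) (hσ' d)
        exact this.trans (t2 _)
      vertex_cycles := by
        intro d d' h
        rw [same_semi hι hσ']
        have e := (hrange (ι d)).1 ⟨d, rfl⟩
        have e' := (hrange (ι d')).1 ⟨d', rfl⟩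
        exact isol_same (isol_same (R.vertex_cycles _ _ h) e.1 e'.1) e.2 e'.2 }
  refine ⟨R', ?_⟩
  let τ' : Perm H.Dart := dartRev H * swap d1 d2
  have τ1 : τ' d1 = d1 := by
    simp only [τ', Perm.mul_apply, swap_apply_left]; rfl
  have τ2 : τ' d2 = d2 := by
    simp only [τ', Perm.mul_apply, swap_apply_right]; rfl
  have hφ : ∀ x, ι (R'.φ x) = (σ2 * τ') (ι x) := by
    intro x
    have e := (hrange (ι x)).1 ⟨x, rfl⟩
    rw [phi_apply]
    simp only [τ', Perm.mul_apply]
    rw [swap_apply_of_ne_of_ne e.1 e.2]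
    exact hσ' x.symm
  have horb := orb_restrict hι hφ (by
    intro d hd
    have : d = d1 ∨ d = d2 := by
      have : d ∈ (Set.range ι)ᶜ := hd
      rw [hcompl] at this; exact this
    rcases this with rfl | rfl
    · rw [Perm.mul_apply, τ1, s21]
    · rw [Perm.mul_apply, τ2, s22])
  rw [hcard] at horb
  have e1 : σ2 * τ' = isol (isol (R.σ * τ') d1) d2 := by
    simp only [σ2, σ1]
    rw [isol_mul _ _ _ τ2, isol_mul _ _ _ τ1]
  rw [e1, orb_isol, orb_isol] at horb
  have c1 : (R.σ * τ') d1 = d1 ↔ Iso (delE H a b) a := by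
    rw [Perm.mul_apply, τ1]; exact fixed_iff R hab
  have c2 : (isol (R.σ * τ') d1) d2 = d2 ↔ Iso (delE H a b) b := by
    rw [← isol_mul _ _ _ τ1, Perm.mul_apply, τ2]
    change σ1 d2 = d2 ↔ _
    rw [s12]
    have := fixed_iff R hab.symm
    have e : delE H b a = delE H a b := by
      unfold delE; rw [Sym2.eq_swap]
    rw [e] at this
    exact this
  have e2 : R.σ * τ' = R.φ * swap d1 d2 := by
    simp only [τ', RotationSystem.φ, mul_assoc]
  simp only [c1, c2] at horb
  rw [e2] at horb
  have hiso := iso_del hab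
  rw [numFaces_eq, numFaces_eq]
  constructor
  · intro hs
    have := orb_mul_swap_same hd12 hs
    split_ifs at horb hiso <;> omega
  · intro hs
    have := orb_mul_swap_not hs
    split_ifs at horb hiso <;> omega

lemma edge_del {V : Type*} [Finite V] {H : SimpleGraph V} {a b : V} (hab : H.Adj a b) :
    Nat.card (delE H a b).edgeSet + 1 = Nat.card H.edgeSet := by
  rw [Nat.card_coe_set_eq, Nat.card_coe_set_eq, SimpleGraph.edgeSet_deleteEdges]
  exact Set.ncard_sdiff_singleton_add_one hab

lemma euler_le {V : Type*} [Fintype V] (n : ℕ) : ∀ (H : SimpleGraph V) (R : RotationSystem H),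
    Nat.card H.edgeSet = n →
    Fintype.card V + R.numFaces + isoN H ≤ Nat.card H.edgeSet + 2 * compN H := by
  induction n with
  | zero =>
    intro H R h0
    have hb : ∀ u w, ¬ H.Adj u w := by
      intro u w huw
      have := edge_del huw
      omega
    have h1 : R.numFaces = 0 := by
      have : IsEmpty H.Dart := ⟨fun d => hb _ _ d.adj⟩
      have : IsEmpty R.Faces := ⟨fun q => Quotient.inductionOn q fun d => this.false d⟩
      exact Nat.card_of_isEmpty
    have h2 : isoN H ≤ Fintype.card V := by
      unfold isoN
      rw [← Nat.card_eq_fintype_card]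
      exact Set.ncard_le_card _
    have h3 : Fintype.card V ≤ compN H := by
      rw [← Nat.card_eq_fintype_card]
      refine Nat.card_le_card_of_injective H.connectedComponentMk ?_
      intro u w huw
      have h : H.Reachable u w := SimpleGraph.ConnectedComponent.exact huw
      have hle : H.reachableSetoid ≤ ⊥ := reach_le (fun u w k => absurd k (hb u w))
      exact hle h
    omega
  | succ n ih =>
    intro H R hn
    have hex : ∃ a b, H.Adj a b := by
      have : Nonempty H.edgeSet := by
        by_contra hcon
        rw [not_nonempty_iff] at hcon
        rw [Nat.card_of_isEmpty] at hn
        omega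
      obtain ⟨⟨e, he⟩⟩ := this
      induction e with
      | h a b => exact ⟨a, b, he⟩
    obtain ⟨a, b, hab⟩ := hex
    obtain ⟨R', h1, h2⟩ := delete_step R hab
    have he := edge_del hab
    have := ih _ R' (by omega)
    by_cases hs : R.φ.SameCycle ⟨(a, b), hab⟩ ⟨(b, a), hab.symm⟩
    · have := h1 hs
      by_cases hr : (delE H a b).Reachable a b
      · have := comp_nonbridge hab hr; omega
      · have := comp_bridge hab hr; omega
    · have := h2 hs
      have hr : (delE H a b).Reachable a b := by
        by_contra hr; exact hs (same_of_bridge R hab hr)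
      have := comp_nonbridge hab hr; omega

lemma planar_del {V : Type*} [Fintype V] {H : SimpleGraph V} (h : IsPlanar H) {a b : V}
    (hab : H.Adj a b) : ∃ R' : RotationSystem (delE H a b),
      Fintype.card V + R'.numFaces + isoN (delE H a b) =
        Nat.card (delE H a b).edgeSet + 2 * compN (delE H a b) := by
  obtain ⟨R, hR⟩ := h
  have hR : Fintype.card V + R.numFaces = Nat.card H.edgeSet + 2 * compN H := hR
  have hle := euler_le _ H R rfl
  obtain ⟨R', h1, h2⟩ := delete_step R hab
  refine ⟨R', ?_⟩
  have he := edge_del hab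
  have hle' := euler_le _ _ R' rfl
  by_cases hs : R.φ.SameCycle ⟨(a, b), hab⟩ ⟨(b, a), hab.symm⟩
  · have := h1 hs
    by_cases hr : (delE H a b).Reachable a b
    · have := comp_nonbridge hab hr; omega
    · have := comp_bridge hab hr; omega
  · have := h2 hs
    have hr : (delE H a b).Reachable a b := by
      by_contra hr; exact hs (same_of_bridge R hab hr)
    have := comp_nonbridge hab hr; omega

end MC
namespace MC

open Equiv Equiv.Perm

lemma planar_comap {V W : Type*} [Fintype V] [Fintype W] {G : SimpleGraph V}
    (R : RotationSystem G)
    (hR : Fintype.card V + R.numFaces + isoN G = Nat.card G.edgeSet + 2 * compN G)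
    (f : W → V) (hf : Function.Injective f) (hr : ∀ v, v ∈ Set.range f ↔ ¬ Iso G v) :
    IsPlanar (G.comap f) ∧ Fintype.card W ≤ Fintype.card V ∧
      Nat.card (G.comap f).edgeSet = Nat.card G.edgeSet := by
  classical
  have hni : ∀ {u w}, G.Adj u w → ∃ x, f x = u := fun {u w} h => (hr u).2 (fun k => k w h)
  let ι : (G.comap f).Dart → G.Dart := fun d => ⟨(f d.fst, f d.snd), d.adj⟩
  have hι : Function.Injective ι := by
    intro d e h
    have h1 := congrArg (fun d : G.Dart => d.fst) h
    have h2 := congrArg (fun d : G.Dart => d.snd) h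
    exact SimpleGraph.Dart.ext _ _ (Prod.ext (hf h1) (hf h2))
  have hsur : Function.Surjective ι := by
    rintro ⟨⟨u, w⟩, h⟩
    obtain ⟨x, rfl⟩ := hni h
    obtain ⟨y, rfl⟩ := hni (SimpleGraph.Adj.symm h)
    exact ⟨⟨(x, y), h⟩, rfl⟩
  obtain ⟨σ', hσ'⟩ := exists_restrict R.σ hι (fun d _ => hsur _)
  let R' : RotationSystem (G.comap f) :=
    { σ := σ'
      tail_fixed := by
        intro d
        have := congrArg (fun d : G.Dart => d.fst) (hσ' d)
        exact hf (this.trans (R.tail_fixed _))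
      vertex_cycles := by
        intro d d' h
        rw [same_semi hι hσ']
        exact R.vertex_cycles _ _ (congrArg f h) }
  have hF : R'.numFaces = R.numFaces := by
    have hφ : ∀ x, ι (R'.φ x) = R.φ (ι x) := fun x => hσ' x.symm
    have := orb_restrict hι hφ (fun d hd => absurd (hsur d) hd)
    rw [numFaces_eq, numFaces_eq, this, hsur.range_eq, Set.compl_univ]
    simp
  have hE : Nat.card (G.comap f).edgeSet = Nat.card G.edgeSet := by
    have hm : ∀ e : (G.comap f).edgeSet, Sym2.map f e.1 ∈ G.edgeSet := by
      rintro ⟨e, he⟩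
      induction e with
      | h a b => exact he
    refine Nat.card_congr (Equiv.ofBijective
      (fun e : (G.comap f).edgeSet => (⟨Sym2.map f e.1, hm e⟩ : G.edgeSet)) ⟨?_, ?_⟩)
    · intro e e' h
      exact Subtype.ext (Sym2.map.injective hf (congrArg Subtype.val h))
    · rintro ⟨e, he⟩
      induction e with
      | h a b =>
        have he' : G.Adj a b := he
        obtain ⟨x, rfl⟩ := hni he'
        obtain ⟨y, rfl⟩ := hni he'.symm
        exact ⟨⟨s(x, y), he⟩, rfl⟩
  have hV : Fintype.card W + isoN G = Fintype.card V := by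
    have h1 : (Set.range f).ncard = Fintype.card W := by
      rw [← Set.image_univ, Set.ncard_image_of_injective _ hf, Set.ncard_univ,
        Nat.card_eq_fintype_card]
    have h2 : {v | Iso G v} = (Set.range f)ᶜ := by
      ext v; rw [Set.mem_compl_iff, hr, not_not]; rfl
    unfold isoN
    rw [h2, ← h1, Set.ncard_add_ncard_compl, Nat.card_eq_fintype_card]
  have hI : isoN (G.comap f) = 0 := by
    unfold isoN
    rw [Set.ncard_eq_zero, Set.eq_empty_iff_forall_notMem]
    intro x hx
    apply (hr (f x)).1 ⟨x, rfl⟩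
    intro w hw
    obtain ⟨y, rfl⟩ := hni hw.symm
    exact hx y hw
  have hC : compN (G.comap f) + isoN G ≤ compN G := by
    have hmono : ∀ x y, G.Reachable (f x) (f y) → (G.comap f).Reachable x y := by
      have : ∀ u w, G.Reachable u w → ∀ x y, f x = u → f y = w → (G.comap f).Reachable x y := by
        rintro u w ⟨p⟩
        induction p with
        | nil => intro x y h1 h2; rw [hf (h1.trans h2.symm)]
        | cons hadj p ih =>
          intro x y h1 h2
          obtain ⟨z, hz⟩ := hni hadj.symm
          refine SimpleGraph.Reachable.trans (SimpleGraph.Adj.reachable (v := z) ?_) (ih z y hz h2)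
          subst h1 hz
          exact hadj
      intro x y h
      exact this _ _ h x y rfl rfl
    have hiso : ∀ u w, G.Reachable u w → Iso G u → u = w := by
      rintro u w ⟨p⟩ hu
      cases p with
      | nil => rfl
      | cons hadj p => exact absurd hadj (hu _)
    have hmap : ∀ x y, (G.comap f).Reachable x y → G.Reachable (f x) (f y) := by
      intro x y h
      have hle : (G.comap f).reachableSetoid ≤ Setoid.comap f G.reachableSetoid :=
        reach_le (fun u w k => (SimpleGraph.Adj.reachable k : G.Reachable (f u) (f w)))
      exact hle h
    unfold compN isoN
    rw [← Nat.card_coe_set_eq, ← Nat.card_sum]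
    let F : (G.comap f).ConnectedComponent ⊕ {v | Iso G v} → G.ConnectedComponent :=
      Sum.elim (Quot.lift (fun x => G.connectedComponentMk (f x))
        (fun x y h => SimpleGraph.ConnectedComponent.sound (hmap x y h)))
        (fun v => G.connectedComponentMk v.1)
    refine Nat.card_le_card_of_injective F ?_
    rintro (p | ⟨u, hu⟩) (q | ⟨w, hw⟩) h
    · induction p using Quot.inductionOn
      induction q using Quot.inductionOn
      rename_i x y
      exact congrArg _ (SimpleGraph.ConnectedComponent.sound
        (hmono x y (SimpleGraph.ConnectedComponent.exact h)))
    · induction p using Quot.inductionOn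
      rename_i x
      exfalso
      have := hiso w (f x) (SimpleGraph.ConnectedComponent.exact h.symm) hw
      exact (hr w).1 ⟨x, this.symm⟩ hw
    · induction q using Quot.inductionOn
      rename_i x
      exfalso
      have := hiso u (f x) (SimpleGraph.ConnectedComponent.exact h) hu
      exact (hr u).1 ⟨x, this.symm⟩ hu
    · have := hiso u w (SimpleGraph.ConnectedComponent.exact h) hu
      subst this; rfl
  have hle := euler_le _ _ R' rfl
  refine ⟨⟨R', ?_⟩, by omega, hE⟩
  change Fintype.card W + R'.numFaces = Nat.card (G.comap f).edgeSet + 2 * compN (G.comap f)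
  omega

lemma vdeg_le_of_hom {V W : Type*} [Finite V] {G : SimpleGraph W} {H : SimpleGraph V}
    (f : G →g H) (hf : Function.Injective f) (x : W) : vdeg G x ≤ vdeg H (f x) := by
  refine Nat.card_le_card_of_injective
    (fun y : G.neighborSet x => (⟨f y.1, f.map_adj y.2⟩ : H.neighborSet (f x))) ?_
  intro y z h
  exact Subtype.ext (hf (congrArg Subtype.val h))

lemma edges_ne {V W : Type*} {G : SimpleGraph W} {H : SimpleGraph V}
    (f : G →g H) (hf : Function.Injective f) {x : W} (c c' : G.Walk x x)
    (h : {e | e ∈ c.edges} ≠ {e | e ∈ c'.edges}) :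
    {e | e ∈ (c.map f).edges} ≠ {e | e ∈ (c'.map f).edges} := by
  intro k
  apply h
  have hs : ∀ c : G.Walk x x, {e | e ∈ (c.map f).edges} = Sym2.map f '' {e | e ∈ c.edges} := by
    intro c; ext e; simp [SimpleGraph.Walk.edges_map]
  rw [hs, hs] at k
  exact (Sym2.map.injective hf).image_injective k

lemma good6_of_hom {V W : Type*} [Finite V] {G : SimpleGraph W} {H : SimpleGraph V}
    (f : G →g H) (hf : Function.Injective f) (hd : ∀ v, vdeg H v ≤ 6) (h : Good6Vertices H) :
    Good6Vertices G := by
  intro x hx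
  have h6 : vdeg H (f x) = 6 := le_antisymm (hd _) (hx ▸ vdeg_le_of_hom f hf x)
  have hcyc : ∀ c : G.Walk x x, c.IsCycle → (c.map f).IsCycle :=
    fun c hc => (SimpleGraph.Walk.isCycle_map_iff_of_injective hf).2 hc
  rcases h (f x) h6 with h | h
  · left
    rintro ⟨c, c', h1, h2, h3, h4, h5, e, he, he'⟩
    refine h ⟨c.map f, c'.map f, hcyc _ h1, hcyc _ h2, by simpa using h3, by simpa using h4,
      edges_ne f hf _ _ h5, Sym2.map f e, ?_, ?_⟩
    · rw [SimpleGraph.Walk.edges_map]; exact List.mem_map_of_mem he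
    · rw [SimpleGraph.Walk.edges_map]; exact List.mem_map_of_mem he'
  · right
    rintro p q l hpql ⟨c1, c2, c3, h1, h2, h3, l1, l2, l3, e1, e2, e3⟩
    exact h p q l hpql ⟨c1.map f, c2.map f, c3.map f, hcyc _ h1, hcyc _ h2, hcyc _ h3,
      by simpa using l1, by simpa using l2, by simpa using l3,
      edges_ne f hf _ _ e1, edges_ne f hf _ _ e2, edges_ne f hf _ _ e3⟩

lemma reduce {V : Type*} [Fintype V] {H : SimpleGraph V} (hmin : MinimalCounterexample H)
    {a b : V} (hab : H.Adj a b) (h6 : ∃ w, vdeg (delE H a b) w = 6) :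
    TotallyColorable (delE H a b) 7 := by
  classical
  obtain ⟨⟨hpl, ⟨hdeg, -⟩, hdia, hhou, hg6⟩, -, hm⟩ := hmin
  have hpd := planar_del hpl hab
  have he := edge_del hab
  set G := delE H a b with hG
  obtain ⟨R, hR⟩ := hpd
  let n := Fintype.card {v // ¬ Iso G v}
  let eq : Fin n ≃ {v // ¬ Iso G v} := (Fintype.equivFin _).symm
  let f : Fin n → V := fun i => (eq i).1
  have hf : Function.Injective f := fun i j h => eq.injective (Subtype.ext h)
  have hr : ∀ v, v ∈ Set.range f ↔ ¬ Iso G v := by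
    intro v
    constructor
    · rintro ⟨i, rfl⟩; exact (eq i).2
    · intro h; exact ⟨eq.symm ⟨v, h⟩, by simp [f]⟩
  obtain ⟨hp', hV, hE⟩ := planar_comap R hR f hf hr
  let F : G.comap f →g H := ⟨f, fun {x y} h => (delE_adj.1 h).1⟩
  have hF : Function.Injective F := hf
  have hgood : GoodGraph (G.comap f) := by
    refine ⟨hp', ⟨fun x => (vdeg_le_of_hom F hF x).trans (hdeg _), ?_⟩, ?_, ?_,
      good6_of_hom F hF hdeg hg6⟩
    · obtain ⟨w, hw⟩ := h6
      have hni : ∀ {u w}, G.Adj u w → ∃ x, f x = u := fun {u w} h => (hr u).2 (fun k => k w h)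
      have : ∃ x, f x = w := by
        have hne : Nonempty (G.neighborSet w) := by
          by_contra hcon
          rw [not_nonempty_iff] at hcon
          unfold vdeg at hw
          rw [Nat.card_of_isEmpty] at hw
          omega
        obtain ⟨⟨z, hz⟩⟩ := hne
        exact hni hz
      obtain ⟨x, rfl⟩ := this
      refine ⟨x, ?_⟩
      rw [← hw]
      refine Nat.card_congr (Equiv.ofBijective
        (fun y : (G.comap f).neighborSet x => (⟨f y.1, y.2⟩ : G.neighborSet (f x))) ⟨?_, ?_⟩)
      · intro y z h
        exact Subtype.ext (hf (congrArg (fun q : G.neighborSet (f x) => q.1) h))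
      · rintro ⟨z, hz⟩
        obtain ⟨y, rfl⟩ := hni (SimpleGraph.Adj.symm hz)
        exact ⟨⟨y, hz⟩, rfl⟩
    · rintro ⟨g, hg, hg'⟩
      exact hdia ⟨F ∘ g, hF.comp hg, fun u v h => F.map_adj (hg' h)⟩
    · rintro ⟨g, hg, hg'⟩
      exact hhou ⟨F ∘ g, hF.comp hg, fun u v h => F.map_adj (hg' h)⟩
  have hcol : TotallyColorable (G.comap f) 7 := by
    by_contra hcon
    have := hm n _ hgood hcon
    have hV' : n ≤ Fintype.card V := by simpa using hV
    rw [hE] at this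
    omega
  obtain ⟨cv, ce, c1, c2, c3⟩ := hcol
  rcases isEmpty_or_nonempty (Fin n) with hemp | hne
  · obtain ⟨w, hw⟩ := h6
    have : Iso G w := by
      by_contra hcon
      obtain ⟨x, -⟩ := (hr w).2 hcon
      exact hemp.false x
    exfalso
    have hne : IsEmpty (G.neighborSet w) := ⟨fun z => this z.1 z.2⟩
    unfold vdeg at hw
    rw [Nat.card_of_isEmpty] at hw
    omega
  let g := Function.invFun f
  have hgf : ∀ x, g (f x) = x := Function.leftInverse_invFun hf
  have hadj : ∀ {u w}, G.Adj u w → f (g u) = u := by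
    intro u w h
    obtain ⟨x, rfl⟩ := (hr u).2 (fun k => k w h)
    rw [hgf]
  have hadj' : ∀ {u w}, G.Adj u w → (G.comap f).Adj (g u) (g w) := by
    intro u w h
    change G.Adj (f (g u)) (f (g w))
    rw [hadj h, hadj h.symm]; exact h
  refine ⟨cv ∘ g, fun e => ce (Sym2.map g e), ?_, ?_, ?_⟩
  · intro u w h; exact c1 (hadj' h)
  · intro e he e' he' hne hx
    obtain ⟨x, hx, hx'⟩ := hx
    have hm : ∀ e ∈ G.edgeSet, Sym2.map g e ∈ (G.comap f).edgeSet ∧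
        Sym2.map f (Sym2.map g e) = e := by
      intro e he
      induction e with
      | h u w => exact ⟨hadj' he, by
          have he : G.Adj u w := he
          simp only [Sym2.map_mk]
          rw [hadj he, hadj he.symm]⟩
    refine c2 _ (hm e he).1 _ (hm e' he').1 (fun k => hne ?_) ⟨g x, ?_, ?_⟩
    · rw [← (hm e he).2, ← (hm e' he').2, k]
    · exact Sym2.mem_map.2 ⟨x, hx, rfl⟩
    · exact Sym2.mem_map.2 ⟨x, hx', rfl⟩
  · intro u w h; exact c3 (hadj' h)

end MC
namespace MC

structure PC {V : Type*} (H : SimpleGraph V) (U : Finset V) (cv : V → Fin 7)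
    (ce : Sym2 V → Fin 7) : Prop where
  hE : ∀ x u w, H.Adj x u → H.Adj x w → u ≠ w → ce s(x, u) ≠ ce s(x, w)
  hV : ∀ u w, u ∉ U → w ∉ U → H.Adj u w → cv u ≠ cv w
  hVE : ∀ u w, u ∉ U → H.Adj u w → ce s(u, w) ≠ cv u

lemma image_card {V : Type*} [Finite V] (H : SimpleGraph V) (x : V) (g : V → Fin 7) :
    (g '' H.neighborSet x).ncard ≤ vdeg H x := by
  unfold vdeg
  rw [Nat.card_coe_set_eq]
  exact Set.ncard_image_le (Set.toFinite _)

lemma exists_avoid (S : Set (Fin 7)) (h : S.ncard ≤ 6) : ∃ c, c ∉ S := by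
  by_contra hcon
  push Not at hcon
  have : S = Set.univ := Set.eq_univ_of_forall hcon
  rw [this, Set.ncard_univ] at h
  simp at h

lemma greedy {V : Type*} [Finite V] (H : SimpleGraph V) (ce : Sym2 V → Fin 7) (U : Finset V) :
    ∀ (cv : V → Fin 7), PC H U cv ce → (∀ u ∈ U, vdeg H u ≤ 3) → TotallyColorable H 7 := by
  classical
  induction U using Finset.induction_on with
  | empty =>
    intro cv h _
    refine ⟨cv, ce, fun u v k => h.hV u v (by simp) (by simp) k, ?_, 
      fun u v k => h.hVE u v (by simp) k⟩
    rintro e he e' he' hne ⟨x, hx, hx'⟩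
    obtain ⟨u, rfl⟩ := Sym2.mem_iff_exists.1 hx
    obtain ⟨w, rfl⟩ := Sym2.mem_iff_exists.1 hx'
    exact h.hE x u w he he' (fun k => hne (by rw [k]))
  | insert u U hu ih =>
    intro cv h hU
    obtain ⟨c, hc⟩ := exists_avoid
      (((fun w => ce s(u, w)) '' H.neighborSet u) ∪ (cv '' H.neighborSet u)) (by
        have h1 := image_card H u (fun w => ce s(u, w))
        have h2 := image_card H u cv
        have h3 := hU u (Finset.mem_insert_self _ _)
        have h4 := Set.ncard_union_le ((fun w => ce s(u, w)) '' H.neighborSet u)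
          (cv '' H.neighborSet u)
        omega)
    have hc1 : ∀ w, H.Adj u w → ce s(u, w) ≠ c := fun w hw k => hc (Or.inl ⟨w, hw, k⟩)
    have hc2 : ∀ w, H.Adj u w → cv w ≠ c := fun w hw k => hc (Or.inr ⟨w, hw, k⟩)
    refine ih (Function.update cv u c) ⟨h.hE, ?_, ?_⟩
      (fun w hw => hU w (Finset.mem_insert_of_mem hw))
    · intro x w hx hw hxw
      by_cases h1 : x = u
      · subst h1
        rw [Function.update_self, Function.update_of_ne hxw.ne']
        exact (hc2 w hxw).symm
      · by_cases h2 : w = u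
        · subst h2
          rw [Function.update_self, Function.update_of_ne h1]
          exact hc2 x hxw.symm
        · rw [Function.update_of_ne h1, Function.update_of_ne h2]
          exact h.hV x w (by simp [h1, hx]) (by simp [h2, hw]) hxw
    · intro x w hx hxw
      by_cases h1 : x = u
      · subst h1
        rw [Function.update_self]
        exact hc1 w hxw
      · rw [Function.update_of_ne h1]
        exact h.hVE x w (by simp [h1, hx]) hxw

/-- Extend a colouring of `H - ab` by colour `c` on `ab`, and recolour vertices by `cv'`. -/
lemma extend {V : Type*} [Finite V] (H : SimpleGraph V) {a b : V}
    (cv cv' : V → Fin 7) (ce : Sym2 V → Fin 7) (U : Finset V) (c : Fin 7)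
    (hdeg : ∀ u ∈ U, vdeg H u ≤ 3)
    (c2 : ∀ e₁ ∈ (delE H a b).edgeSet, ∀ e₂ ∈ (delE H a b).edgeSet, e₁ ≠ e₂ →
      (∃ x, x ∈ e₁ ∧ x ∈ e₂) → ce e₁ ≠ ce e₂)
    (ha : ∀ w, H.Adj a w → w ≠ b → ce s(a, w) ≠ c)
    (hb : ∀ w, H.Adj b w → w ≠ a → ce s(b, w) ≠ c)
    (hV : ∀ u w, u ∉ U → w ∉ U → H.Adj u w → cv' u ≠ cv' w)
    (hVE : ∀ u w, u ∉ U → (delE H a b).Adj u w → ce s(u, w) ≠ cv' u)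
    (hca : a ∉ U → c ≠ cv' a) (hcb : b ∉ U → c ≠ cv' b) : TotallyColorable H 7 := by
  classical
  have key : ∀ x w, H.Adj x w → s(x, w) ≠ s(a, b) → s(x, w) ∈ (delE H a b).edgeSet :=
    fun x w h h' => delE_adj.2 ⟨h, h'⟩
  have hinc : ∀ x u w, s(x, u) = s(a, b) → H.Adj x w → u ≠ w → ce s(x, w) ≠ c := by
    intro x u w h hw hne
    rcases Sym2.eq_iff.1 h with ⟨rfl, rfl⟩ | ⟨rfl, rfl⟩
    · exact ha w hw hne.symm
    · exact hb w hw hne.symm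
  refine greedy H (Function.update ce s(a, b) c) U cv' ⟨?_, hV, ?_⟩ hdeg
  · intro x u w hu hw hne
    have hne' : s(x, u) ≠ s(x, w) := fun k => hne (Sym2.congr_right.1 k)
    by_cases h1 : s(x, u) = s(a, b)
    · have h2 : s(x, w) ≠ s(a, b) := fun k => hne' (h1.trans k.symm)
      rw [h1, Function.update_self, Function.update_of_ne h2]
      exact (hinc x u w h1 hw hne).symm
    · by_cases h2 : s(x, w) = s(a, b)
      · rw [h2, Function.update_self, Function.update_of_ne h1]
        exact hinc x w u h2 hu hne.symm
      · rw [Function.update_of_ne h1, Function.update_of_ne h2]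
        exact c2 _ (key _ _ hu h1) _ (key _ _ hw h2) hne' ⟨x, by simp, by simp⟩
  · intro u w hu huw
    by_cases h1 : s(u, w) = s(a, b)
    · rw [h1, Function.update_self]
      rcases Sym2.eq_iff.1 h1 with ⟨rfl, rfl⟩ | ⟨rfl, rfl⟩
      · exact hca hu
      · exact hcb hu
    · rw [Function.update_of_ne h1]
      exact hVE u w hu (delE_adj.2 ⟨huw, h1⟩)

lemma vdeg_del {V : Type*} {H : SimpleGraph V} {a b w : V} (ha : w ≠ a) (hb : w ≠ b) :
    vdeg (delE H a b) w = vdeg H w := by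
  unfold vdeg
  have : (delE H a b).neighborSet w = H.neighborSet w := by
    ext z
    simp only [SimpleGraph.mem_neighborSet]
    rw [delE_adj]
    refine ⟨fun h => h.1, fun h => ⟨h, fun k => ?_⟩⟩
    rcases Sym2.eq_iff.1 k with ⟨h1, h2⟩ | ⟨h1, h2⟩
    · exact ha h1
    · exact hb h1
  rw [this]

/-- colours around `a` other than on the edge `ab` -/
lemma around {V : Type*} [Finite V] {H : SimpleGraph V} {a b : V} (hab : H.Adj a b)
    (ce : Sym2 V → Fin 7) (c : Fin 7) :
    (insert c ((fun w => ce s(a, w)) '' (H.neighborSet a \ {b}))).ncard ≤ vdeg H a := by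
  have h1 : (H.neighborSet a \ {b}).ncard + 1 = vdeg H a := by
    unfold vdeg
    rw [Nat.card_coe_set_eq]
    exact Set.ncard_sdiff_singleton_add_one hab
  have h2 : ((fun w => ce s(a, w)) '' (H.neighborSet a \ {b})).ncard ≤
    (H.neighborSet a \ {b}).ncard := Set.ncard_image_le (Set.toFinite _)
  have h3 := Set.ncard_insert_le c ((fun w => ce s(a, w)) '' (H.neighborSet a \ {b}))
  omega

lemma main {V : Type*} [Fintype V] (H : SimpleGraph V)
    (hmin : MinimalCounterexample H) (v x : V) (hv6 : vdeg H v = 6) (hvx : H.Adj v x)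
    (hx2 : vdeg H x = 2) (hall : ∀ w, H.Adj v w → vdeg H w ≤ 3) : False := by
  classical
  have hnc : ¬ TotallyColorable H 7 := hmin.2.1
  have hd6 := hmin.1.2.1.1
  obtain ⟨y, hxy, hyv, hN⟩ : ∃ y, H.Adj x y ∧ y ≠ v ∧ ∀ w, H.Adj x w → w = v ∨ w = y := by
    have h1 : (H.neighborSet x).ncard = 2 := by rw [← Nat.card_coe_set_eq]; exact hx2
    obtain ⟨p, q, hpq, hs⟩ := Set.ncard_eq_two.1 h1
    have hm : ∀ w, H.Adj x w ↔ w = p ∨ w = q := by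
      intro w
      rw [← SimpleGraph.mem_neighborSet, hs]; simp
    rcases (hm v).1 hvx.symm with rfl | rfl
    · exact ⟨q, (hm q).2 (Or.inr rfl), hpq.symm, fun w hw => (hm w).1 hw⟩
    · exact ⟨p, (hm p).2 (Or.inl rfl), hpq, fun w hw => ((hm w).1 hw).symm⟩
  have hUx : ∀ u ∈ ({x} : Finset V), vdeg H u ≤ 3 := by
    intro u hu; rw [Finset.mem_singleton] at hu; subst hu; omega
  -- the other neighbour of x has degree six
  have hy6 : vdeg H y = 6 := by
    by_contra hy
    have hy5 : vdeg H y ≤ 5 := by have := hd6 y; omega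
    apply hnc
    obtain ⟨cv, ce, c1, c2, c3⟩ := reduce hmin hxy ⟨v, by
      rw [vdeg_del hvx.ne hyv.symm]; exact hv6⟩
    obtain ⟨c, hc⟩ := exists_avoid (insert (ce s(x, v)) (insert (cv y)
        ((fun w => ce s(y, w)) '' (H.neighborSet y \ {x})))) (by
      have h1 := around hxy.symm ce (cv y)
      have h2 := Set.ncard_insert_le (ce s(x, v)) (insert (cv y)
        ((fun w => ce s(y, w)) '' (H.neighborSet y \ {x})))
      omega)
    simp only [Set.mem_insert_iff, not_or] at hc
    obtain ⟨hc1, hc2, hc3⟩ := hc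
    refine extend H cv cv ce {x} c hUx c2 ?_ ?_ ?_ ?_ ?_ ?_
    · intro w hw hwy
      rcases hN w hw with rfl | rfl
      · exact Ne.symm hc1
      · exact absurd rfl hwy
    · intro w hw hwx k
      exact hc3 ⟨w, ⟨hw, hwx⟩, k⟩
    · intro u w hu hw huw
      rw [Finset.mem_singleton] at hu hw
      refine c1 (delE_adj.2 ⟨huw, fun k => ?_⟩)
      rcases Sym2.eq_iff.1 k with ⟨h1, h2⟩ | ⟨h1, h2⟩
      · exact hu h1
      · exact hw h2
    · intro u w hu huw
      exact c3 huw
    · intro h; simp at h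
    · intro _; exact hc2
  obtain ⟨cv, ce, c1, c2, c3⟩ := reduce hmin hvx ⟨y, by
      rw [vdeg_del hyv hxy.ne']; exact hy6⟩
  apply hnc
  have hadjv : ∀ w, H.Adj v w → w ≠ x → (delE H v x).Adj v w := by
    intro w hw hwx
    refine delE_adj.2 ⟨hw, fun k => hwx (Sym2.congr_right.1 k)⟩
  set A := insert (cv v) ((fun w => ce s(v, w)) '' (H.neighborSet v \ {x})) with hA
  have hA6 : A.ncard ≤ 6 := hv6 ▸ around hvx ce (cv v)
  by_cases hex : ∃ c, c ∉ A ∧ c ≠ ce s(x, y)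
  · obtain ⟨c, hcA, hcy⟩ := hex
    simp only [hA, Set.mem_insert_iff, not_or] at hcA
    obtain ⟨hc2, hc3⟩ := hcA
    refine extend H cv cv ce {x} c hUx c2 ?_ ?_ ?_ ?_ ?_ ?_
    · intro w hw hwx k
      exact hc3 ⟨w, ⟨hw, hwx⟩, k⟩
    · intro w hw hwv
      rcases hN w hw with rfl | rfl
      · exact absurd rfl hwv
      · exact hcy.symm
    · intro u w hu hw huw
      rw [Finset.mem_singleton] at hu hw
      refine c1 (delE_adj.2 ⟨huw, fun k => ?_⟩)
      rcases Sym2.eq_iff.1 k with ⟨h1, h2⟩ | ⟨h1, h2⟩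
      · exact hw h2
      · exact hu h1
    · intro u w hu huw
      exact c3 huw
    · intro _; exact hc2
    · intro h; simp at h
  · push Not at hex
    obtain ⟨c, hc⟩ := exists_avoid A hA6
    have hcy := hex c hc
    rw [hcy] at hc
    simp only [hA, Set.mem_insert_iff, not_or] at hc
    obtain ⟨hc2, hc3⟩ := hc
    have hUm : ∀ u, u ∈ (Set.toFinite (H.neighborSet v)).toFinset ↔ H.Adj v u := by
      intro u; rw [Set.Finite.mem_toFinset]; rfl
    refine extend H cv (Function.update cv v (ce s(x, y))) ce
      (Set.toFinite (H.neighborSet v)).toFinset (cv v) ?_ c2 ?_ ?_ ?_ ?_ ?_ ?_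
    · intro u hu; exact hall u ((hUm u).1 hu)
    · intro w hw hwx
      exact c3 (hadjv w hw hwx)
    · intro w hw hwv
      rcases hN w hw with rfl | rfl
      · exact absurd rfl hwv
      · exact hc2
    · intro u w hu hw huw
      rw [hUm] at hu hw
      have h1 : u ≠ v := by rintro rfl; exact hw huw
      have h2 : w ≠ v := by rintro rfl; exact hu huw.symm
      rw [Function.update_of_ne h1, Function.update_of_ne h2]
      refine c1 (delE_adj.2 ⟨huw, fun k => ?_⟩)
      rcases Sym2.eq_iff.1 k with ⟨h3, h4⟩ | ⟨h3, h4⟩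
      · exact h1 h3
      · exact h2 h4
    · intro u w hu huw
      by_cases h1 : u = v
      · subst h1
        rw [Function.update_self]
        intro k
        have h := delE_adj.1 huw
        exact hc3 ⟨w, ⟨h.1, fun k' => h.2 (by rw [Set.mem_singleton_iff.1 k'])⟩, k⟩
      · rw [Function.update_of_ne h1]
        exact c3 huw
    · intro _
      rw [Function.update_self]; exact Ne.symm hc2
    · intro h; exact absurd ((hUm x).2 hvx) h

end MC

/-- **Lemma.** In a minimal counterexample, every vertex of degree 6 adjacent to a vertex
of degree 2 has at most five neighbors of degree at most 3. -/
theorem minimal_counterexample_six_vertex_with_two_neighbor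
    {V : Type*} [Fintype V] (H : SimpleGraph V)
    (hmin : MinimalCounterexample H)
    (v : V) (hv6 : vdeg H v = 6)
    (hv2 : ∃ x, H.Adj v x ∧ vdeg H x = 2) :
    Nat.card {x : V | H.Adj v x ∧ vdeg H x ≤ 3} ≤ 5 := by

  by_contra hcon
  push Not at hcon
  obtain ⟨x, hvx, hx2⟩ := hv2
  refine MC.main H hmin v x hv6 hvx hx2 ?_
  have hsub : {x : V | H.Adj v x ∧ vdeg H x ≤ 3} ⊆ H.neighborSet v := fun w hw => hw.1
  have heq : {x : V | H.Adj v x ∧ vdeg H x ≤ 3} = H.neighborSet v := by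
    apply Set.eq_of_subset_of_ncard_le hsub _ (Set.toFinite _)
    rw [← Nat.card_coe_set_eq, ← Nat.card_coe_set_eq]
    unfold vdeg at hv6
    rw [hv6]
    exact hcon
  intro w hw
  have : w ∈ {x : V | H.Adj v x ∧ vdeg H x ≤ 3} := by rw [heq]; exact hw
  exact this.2
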